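/- For every k ∈ ℤ, every r ∈ {1,…,n} and every q ∈ U_n: V_r^{(k)} = −Σ_{j=0}^{n−r} q_{r+j}·V_1^{(k−1−j)}, i.e. V_r^{(k)} = −q_r·V_1^{(k−1)} − q_{r+1}·V_1^{(k−2)} − … − q_n·V_1^{(k−n+r−1)}. -/

import Mathlib

open scoped BigOperators

/-- Coordinate of `q` with the conventions `q₀ = 1` and `q_α = 0` for `α < 0` or `α > n`
(1-based indexing by an integer). -/
def qc (n : ℕ) (q : Fin n → ℝ) (r : ℤ) : ℝ :=
  if r = 0 then 1
  else if h : 1 ≤ r ∧ r ≤ (n : ℤ) then q ⟨(r - 1).toNat, by omega⟩ else 0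

/-- The Benenti potentials `V_r^{(k)}` in `n` variables. -/
noncomputable def benenti (n : ℕ) (r k : ℤ) (q : Fin n → ℝ) : ℝ :=
  if r < 1 ∨ (n : ℤ) < r then 0
  else if k = 0 then (if r = (n : ℤ) then 1 else 0)
  else if 0 < k then
    benenti n (r + 1) (k - 1) q - qc n q r * benenti n 1 (k - 1) q
  else
    benenti n (r - 1) (k + 1) q - (qc n q (r - 1) / qc n q n) * benenti n n (k + 1) q
termination_by k.natAbs
decreasing_by all_goals omega

/-- Partial derivative of `f` with respect to the `i`-th coordinate at `q`. -/
noncomputable def pd {n : ℕ} (f : (Fin n → ℝ) → ℝ) (i : Fin n) (q : Fin n → ℝ) : ℝ :=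
  deriv (fun t => f (Function.update q i t)) (q i)

/-- Euler–Lagrange expression `E_l(L)[c](x)` of a Lagrangian density `L(q,p)`
along a curve `c`. -/
noncomputable def elExpr {n : ℕ} (L : (Fin n → ℝ) → (Fin n → ℝ) → ℝ) (l : Fin n)
    (c : ℝ → Fin n → ℝ) (x : ℝ) : ℝ :=
  pd (fun vq => L vq (deriv c x)) l (c x)
    - deriv (fun y => pd (fun vp => L (c y) vp) l (deriv c y)) x

/-- The Lagrangian density `L^{n,m,k}`. -/
noncomputable def lag (n : ℕ) (m k : ℤ) (q p : Fin n → ℝ) : ℝ :=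
  (1 / 2) * ∑ i : Fin n, ∑ j : Fin n,
      benenti n 1 (2 * (n : ℤ) - m - ((i : ℕ) + 1) - ((j : ℕ) + 1)) q * p i * p j
    - benenti n 1 k q

/-- The matrix `L` of the Benenti class in Viète coordinates. -/
def Lmat (n : ℕ) (q : Fin n → ℝ) : Matrix (Fin n) (Fin n) ℝ :=
  Matrix.of fun i j => if (j : ℕ) = 0 then -q i else if (j : ℕ) = (i : ℕ) + 1 then 1 else 0

theorem benenti_out (n : ℕ) (r k : ℤ) (q : Fin n → ℝ) (h : r < 1 ∨ (n : ℤ) < r) :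
    benenti n r k q = 0 := by
  rw [benenti, if_pos h]

theorem benenti_down (n : ℕ) (r k : ℤ) (q : Fin n → ℝ) (h1 : 1 ≤ r) (h2 : r ≤ n) (hk : k ≤ 0) :
    benenti n r (k - 1) q
      = benenti n (r - 1) k q - (qc n q (r - 1) / qc n q n) * benenti n n k q := by
  rw [benenti, if_neg (by omega), if_neg (by omega), if_neg (by omega)]
  simp only [sub_add_cancel]

theorem benenti_up (n : ℕ) (r k : ℤ) (q : Fin n → ℝ) (h1 : 1 ≤ r) (h2 : r ≤ n)
    (hq : qc n q n ≠ 0) :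
    benenti n r k q = benenti n (r + 1) (k - 1) q - qc n q r * benenti n 1 (k - 1) q := by
  by_cases hk : 0 < k
  · rw [benenti, if_neg (by omega), if_neg (by omega), if_pos hk]
  · have e1 := benenti_down n 1 k q (by omega) (by omega) (by omega)
    rw [benenti_out n (1 - 1) k q (by omega)] at e1
    have q0 : qc n q (1 - 1) = 1 := by simp [qc]
    rw [q0] at e1
    rw [e1]
    by_cases hr : r = n
    · subst hr
      rw [benenti_out n _ (k - 1) q (by omega)]
      field_simp
      ring
    · rw [benenti_down n (r + 1) k q (by omega) (by omega) (by omega)]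
      simp only [add_sub_cancel_right]
      ring

theorem benenti_aux (n : ℕ) (q : Fin n → ℝ) (hq : qc n q n ≠ 0) (d : ℕ) :
    ∀ (r k : ℤ), 1 ≤ r → r + d = n → benenti n r k q
      = -∑ j ∈ Finset.range (d + 1), qc n q (r + j) * benenti n 1 (k - 1 - j) q := by
  induction d with
  | zero =>
    intro r k h1 h2
    rw [benenti_up n r k q h1 (by omega) hq, benenti_out n (r + 1) _ q (by push_cast at h2; omega)]
    simp
  | succ d ih =>
    intro r k h1 h2
    push_cast at h2
    rw [benenti_up n r k q h1 (by omega) hq, ih (r + 1) (k - 1) (by omega) (by omega),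
      Finset.sum_range_succ' _ (d + 1)]
    have : ∀ j : ℕ, qc n q (r + ((j + 1 : ℕ) : ℤ)) * benenti n 1 (k - 1 - ((j + 1 : ℕ) : ℤ)) q
        = qc n q (r + 1 + j) * benenti n 1 (k - 1 - 1 - j) q := by
      intro j
      congr 2
      · push_cast; ring
      · push_cast; ring
    simp only [this]
    simp
    ring

/-- for every `k ∈ ℤ`, `r ∈ {1,…,n}` and `q ∈ U_n`:
`V_r^{(k)} = −Σ_{j=0}^{n−r} q_{r+j}·V₁^{(k−1−j)}`. -/
theorem benenti_downward_expansion
    (n : ℕ) (hn : 1 ≤ n) (k : ℤ) (r : ℕ) (hr1 : 1 ≤ r) (hr2 : r ≤ n)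
    (q : Fin n → ℝ) (hq : q ⟨n - 1, by omega⟩ ≠ 0) :
    benenti n r k q
      = -∑ j ∈ Finset.range (n - r + 1),
          qc n q ((r : ℤ) + j) * benenti n 1 (k - 1 - j) q := by
  refine benenti_aux n q ?_ (n - r) r k (by omega) (by omega)
  have e : qc n q n = q ⟨n - 1, by omega⟩ := by
    unfold qc
    rw [if_neg (by omega), dif_pos (by omega)]
    congr 2
    omega
  rw [e]
  exact hq
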